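/- arXiv:2312.08123 — 2 statements merged into one kernel-verified Lean document; each statement's English description precedes it below -/
import Mathlib

section
/- For every f ∈ C_c^∞(ℝ²) one has the stability estimate ‖f‖_{L²(ℝ²)} ≤ (1/√2) ‖Rf‖_{H^{1/2}_T(ℝ×S¹)}, where the norm on the right is ‖(1+σ²)^{1/4} (Rf)~(σ,ω)‖_{L²(ℝ×S¹)}. -/
open MeasureTheory Complex Real

/-- Rotation of `ω ∈ ℝ²` counterclockwise by 90 degrees. -/
noncomputable def perp (ω : ℝ × ℝ) : ℝ × ℝ := (-ω.2, ω.1)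

/-- The unit vector at angle `θ`. -/
noncomputable def ang (θ : ℝ) : ℝ × ℝ := (Real.cos θ, Real.sin θ)

/-- The Radon transform, with the direction parametrized by its angle `θ`. -/
noncomputable def radonTransform (f : ℝ × ℝ → ℂ) (s θ : ℝ) : ℂ :=
  ∫ t : ℝ, f (s • perp (ang θ) + t • ang θ)

/-- The 1D Fourier transform of the Radon transform in the variable `s`. -/
noncomputable def radonFT (f : ℝ × ℝ → ℂ) (σ θ : ℝ) : ℂ :=
  ∫ s : ℝ, Complex.exp (-Complex.I * (σ * s : ℝ)) * radonTransform f s θ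

/-- The function `f` seen on the complex plane. -/
noncomputable def cfun (f : ℝ × ℝ → ℂ) (z : ℂ) : ℂ := f (z.re, z.im)

lemma cfun_contDiff {f : ℝ × ℝ → ℂ} (hf : ContDiff ℝ (⊤ : ℕ∞) f) :
    ContDiff ℝ (⊤ : ℕ∞) (cfun f) :=
  hf.comp (Complex.reCLM.contDiff.prodMk Complex.imCLM.contDiff)

lemma cfun_supp {f : ℝ × ℝ → ℂ} (hf : HasCompactSupport f) :
    HasCompactSupport (cfun f) :=
  hf.comp_homeomorph Complex.equivRealProdCLM.toHomeomorph

lemma slice {f : ℝ × ℝ → ℂ} (hf : Continuous f) (hs : HasCompactSupport f) (σ θ : ℝ) :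
    radonFT f σ θ = FourierTransform.fourier (cfun f)
      (((σ / (2 * π) : ℝ) : ℂ) * (Complex.I * Complex.exp (θ * Complex.I))) := by
  rw [Real.fourier_eq']
  set w : ℂ := (((σ / (2 * π) : ℝ) : ℂ) * (Complex.I * Complex.exp (θ * Complex.I))) with hw
  set F : ℂ → ℂ := fun v => Complex.exp (↑(-2 * π * inner ℝ v w) * Complex.I) • cfun f v with hF
  have hgc : Continuous (cfun f) := by unfold cfun; fun_prop
  have hFi : Integrable F := by
    apply Continuous.integrable_of_hasCompactSupport
    · have h1 : Continuous fun v : ℂ => inner ℝ v w := continuous_id.inner continuous_const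
      have h2 : Continuous fun v : ℂ => Complex.exp (↑(-2 * π * inner ℝ v w) * Complex.I) :=
        Complex.continuous_exp.comp
          ((Complex.continuous_ofReal.comp (continuous_const.mul h1)).mul continuous_const)
      exact h2.smul hgc
    · refine (cfun_supp hs).mono fun x hx h0 => hx ?_
      rw [hF]
      simp only [h0, smul_zero]
  set ρ : ℂ ≃ₗᵢ[ℝ] ℂ := rotation (Circle.exp θ) with hρ
  have hmp := ρ.measurePreserving
  have hemb : MeasurableEmbedding ρ := ρ.toHomeomorph.measurableEmbedding
  have hmq := Complex.volume_preserving_equiv_real_prod.symm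
  have hembq := Complex.measurableEquivRealProd.symm.measurableEmbedding
  have hFi1 : Integrable (F ∘ ρ) := (hmp.integrable_comp_emb hemb).2 hFi
  have hFi2 := (hmq.integrable_comp_emb hembq).2 hFi1
  rw [← hmp.integral_comp hemb, ← hmq.integral_comp hembq]
  refine Eq.trans ?_ (integral_prod_symm _ hFi2).symm
  unfold radonFT radonTransform
  congr 1
  ext s
  rw [← integral_const_mul]
  congr 1
  ext t
  have key : ρ (Complex.measurableEquivRealProd.symm (t, s))
      = (t + s * Complex.I) * Complex.exp (θ * Complex.I) := by
    rw [hρ, rotation_apply, Circle.coe_exp, mul_comm]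
    congr 1
    apply Complex.ext <;> simp [Complex.measurableEquivRealProd_symm_apply]
  have hcs := Real.cos_sq_add_sin_sq θ
  have hinner : inner ℝ (ρ (Complex.measurableEquivRealProd.symm (t, s))) w = s * (σ / (2 * π)) := by
    rw [key, Complex.inner, hw, Complex.exp_mul_I, ← Complex.ofReal_cos, ← Complex.ofReal_sin]
    generalize σ / (2 * π) = r
    simp [-Complex.ofReal_cos, -Complex.ofReal_sin]
    linear_combination (s * r) * hcs
  simp only [hF, Function.comp_apply]
  rw [hinner, key, smul_eq_mul]
  congr 1
  · congr 1
    have : (-2 * π * (s * (σ / (2 * π)))) = -(σ * s) := by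
      field_simp
    rw [this]; push_cast; ring
  · rw [Complex.exp_mul_I, ← Complex.ofReal_cos, ← Complex.ofReal_sin]
    unfold cfun perp ang
    congr 1
    ext <;> simp [-Complex.ofReal_cos, -Complex.ofReal_sin] <;> ring

lemma schwartz_bound (G : SchwartzMap ℂ ℂ) :
    ∃ C : ℝ, 0 ≤ C ∧ ∀ w : ℂ, ‖G w‖ ^ 2 ≤ C * ((1 + ‖w‖ ^ 2)⁻¹) ^ 2 := by
  obtain ⟨C0, h0, hC0⟩ := G.decay 0 0
  obtain ⟨C2, h2, hC2⟩ := G.decay 2 0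
  refine ⟨(C0 + C2) ^ 2, by positivity, fun w => ?_⟩
  have a := hC0 w
  have b := hC2 w
  simp only [norm_iteratedFDeriv_zero, pow_zero, one_mul] at a b
  rw [← mul_pow]
  apply pow_le_pow_left₀ (norm_nonneg _)
  rw [← div_eq_mul_inv, le_div_iff₀ (by positivity)]
  linarith

/-- Angular mean of `‖G‖²`. -/
noncomputable def Hm (G : SchwartzMap ℂ ℂ) (r : ℝ) : ℝ :=
  ∫ θ in (-π)..π, ‖G (r * Complex.exp (θ * Complex.I))‖ ^ 2

lemma Hm_cont (G : SchwartzMap ℂ ℂ) : Continuous (Hm G) := by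
  unfold Hm
  apply intervalIntegral.continuous_parametric_intervalIntegral_of_continuous'
  have := G.continuous
  simp only [Function.uncurry_def]
  fun_prop

lemma norm_polar (r θ : ℝ) : ‖(r : ℂ) * Complex.exp (θ * Complex.I)‖ ^ 2 = r ^ 2 := by
  rw [norm_mul, Complex.norm_exp_ofReal_mul_I, mul_one, Complex.norm_real, Real.norm_eq_abs, sq_abs]

lemma Hm_nonneg (G : SchwartzMap ℂ ℂ) (r : ℝ) : 0 ≤ Hm G r := by
  apply intervalIntegral.integral_nonneg (by linarith [Real.pi_pos])
  intro θ _
  positivity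

lemma Hm_bound (G : SchwartzMap ℂ ℂ) :
    ∃ C : ℝ, 0 ≤ C ∧ ∀ r, Hm G r ≤ C * ((1 + r ^ 2)⁻¹) ^ 2 := by
  obtain ⟨C, hC, h⟩ := schwartz_bound G
  refine ⟨C * (2 * π), by positivity, fun r => ?_⟩
  have hG := G.continuous
  calc Hm G r ≤ ∫ θ in (-π)..π, C * ((1 + r ^ 2)⁻¹) ^ 2 := by
        apply intervalIntegral.integral_mono_on (by linarith [Real.pi_pos])
        · apply Continuous.intervalIntegrable; fun_prop
        · simp
        · intro θ _
          have := h (r * Complex.exp (θ * Complex.I))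
          rwa [norm_polar] at this
    _ = _ := by simp; ring

lemma polar_eq (G : SchwartzMap ℂ ℂ) :
    ∫ w : ℂ, ‖G w‖ ^ 2 = ∫ r in Set.Ioi (0:ℝ), r * Hm G r := by
  have hG := G.continuous
  obtain ⟨C, hC, h⟩ := schwartz_bound G
  rw [← Complex.integral_comp_polarCoord_symm, polarCoord_target, Measure.volume_eq_prod]
  have e : ∀ p : ℝ × ℝ, p.1 • ‖G (Complex.polarCoord.symm p)‖ ^ 2
      = p.1 * ‖G (p.1 * Complex.exp (p.2 * Complex.I))‖ ^ 2 := by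
    intro p
    rw [Complex.polarCoord_symm_apply, Complex.exp_mul_I, Complex.ofReal_cos, Complex.ofReal_sin,
      smul_eq_mul]
  simp_rw [e]
  rw [setIntegral_prod]
  · congr 1
    ext r
    rw [Hm, intervalIntegral.integral_of_le (by linarith [Real.pi_pos]),
      ← integral_Ioc_eq_integral_Ioo, integral_const_mul]
  · rw [IntegrableOn, ← Measure.prod_restrict]
    have hb : Integrable (fun p : ℝ × ℝ => (C * (1 + p.1 ^ 2)⁻¹) * (1:ℝ))
        ((volume.restrict (Set.Ioi 0)).prod (volume.restrict (Set.Ioo (-π) π))) :=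
      Integrable.mul_prod (f := fun x : ℝ => C * (1 + x ^ 2)⁻¹) (g := fun _ : ℝ => (1:ℝ))
        ((integrable_inv_one_add_sq.const_mul C).restrict) (integrable_const _)
    refine hb.mono' (Continuous.aestronglyMeasurable (by fun_prop)) (ae_of_all _ fun p => ?_)
    have h1 := h (p.1 * Complex.exp (p.2 * Complex.I))
    rw [norm_polar] at h1
    rw [norm_mul, Real.norm_eq_abs, Real.norm_of_nonneg (by positivity), mul_one]
    have h2 : |p.1| ≤ 1 + p.1 ^ 2 := by
      rw [← sq_abs]; nlinarith [sq_nonneg (|p.1| - 1), abs_nonneg p.1]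
    calc _ ≤ (1 + p.1 ^ 2) * (C * ((1 + p.1 ^ 2)⁻¹) ^ 2) := by gcongr
      _ = _ := by
        have : 1 + p.1 ^ 2 ≠ 0 := by positivity
        field_simp

lemma angular (G : SchwartzMap ℂ ℂ) (r : ℝ) :
    ∫ θ in (0:ℝ)..(2 * π), ‖G (r * (Complex.I * Complex.exp (θ * Complex.I)))‖ ^ 2 = Hm G r := by
  set φ : ℝ → ℝ := fun θ => ‖G (r * Complex.exp (θ * Complex.I))‖ ^ 2 with hφ
  have hp : Function.Periodic φ (2 * π) := by
    intro θ
    simp only [hφ]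
    push_cast
    rw [add_mul, Complex.exp_add, Complex.exp_two_pi_mul_I, mul_one]
  have e : ∀ θ : ℝ, ‖G (r * (Complex.I * Complex.exp (θ * Complex.I)))‖ ^ 2 = φ (θ + π / 2) := by
    intro θ
    simp only [hφ]
    push_cast
    rw [add_mul, Complex.exp_add, Complex.exp_pi_div_two_mul_I, mul_comm Complex.I]
  simp_rw [e]
  rw [intervalIntegral.integral_comp_add_right]
  have := hp.intervalIntegral_add_eq (0 + π / 2) (-π)
  rw [show 2 * π + π / 2 = 0 + π / 2 + 2 * π by ring, this, Hm]
  congr 1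
  ring

/-- Stability estimate for the Radon transform:
`‖f‖_{L²(ℝ²)} ≤ (1/√2) ‖Rf‖_{H^{1/2}_T(ℝ×S¹)}`, where
`‖Rf‖_{H^{1/2}_T}² = ∫∫ (1+σ²)^{1/2} |(Rf)~(σ,θ)|² dθ dσ`. -/
theorem radon_stability (f : ℝ × ℝ → ℂ) (hf : ContDiff ℝ (⊤ : ℕ∞) f)
    (hsupp : HasCompactSupport f) :
    Real.sqrt (∫ x : ℝ × ℝ, ‖f x‖ ^ 2)
      ≤ (1 / Real.sqrt 2) *
        Real.sqrt (∫ σ : ℝ, ∫ θ in (0:ℝ)..(2 * π),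
          Real.sqrt (1 + σ ^ 2) * ‖radonFT f σ θ‖ ^ 2) := by
  have hc := hf.continuous
  set G : SchwartzMap ℂ ℂ :=
    FourierTransform.fourier ((cfun_supp hsupp).toSchwartzMap (cfun_contDiff hf)) with hG
  have hGf : ∀ w, FourierTransform.fourier (cfun f) w = G w := by
    intro w
    rw [hG, SchwartzMap.fourier_coe]
    rfl
  have hL : ∫ x : ℝ × ℝ, ‖f x‖ ^ 2 = ∫ r in Set.Ioi (0:ℝ), r * Hm G r := by
    rw [← polar_eq, hG, SchwartzMap.integral_norm_sq_fourier,
      ← Complex.volume_preserving_equiv_real_prod.integral_comp']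
    rfl
  have hR : ∀ σ : ℝ, (∫ θ in (0:ℝ)..(2 * π), Real.sqrt (1 + σ ^ 2) * ‖radonFT f σ θ‖ ^ 2)
      = Real.sqrt (1 + σ ^ 2) * Hm G (σ / (2 * π)) := by
    intro σ
    rw [intervalIntegral.integral_const_mul, ← angular]
    simp_rw [slice hc hsupp, hGf]
  simp_rw [hR]
  have hpi := Real.pi_gt_three
  have hsc : ∫ σ in Set.Ioi (0:ℝ), σ * Hm G (σ / (2 * π))
      = (2 * π) ^ 2 * ∫ r in Set.Ioi (0:ℝ), r * Hm G r := by
    have := integral_comp_mul_left_Ioi (fun σ => σ * Hm G (σ / (2 * π))) 0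
      (b := 2 * π) (by positivity)
    have e : ∀ r : ℝ, 2 * π * r * Hm G (2 * π * r / (2 * π)) = 2 * π * (r * Hm G r) := by
      intro r
      rw [mul_div_cancel_left₀ _ (by positivity)]; ring
    simp_rw [e] at this
    rw [integral_const_mul, mul_zero, smul_eq_mul] at this
    rw [sq, mul_assoc, this, mul_inv_cancel_left₀ (by positivity)]
  have hcont := Hm_cont G
  have hint : Integrable (fun σ : ℝ => Real.sqrt (1 + σ ^ 2) * Hm G (σ / (2 * π))) := by
    obtain ⟨C, hC, hb⟩ := Hm_bound G
    refine ((integrable_inv_one_add_sq.comp_div (R := 2 * π) (by positivity)).const_mul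
      ((2 * π) ^ 2 * C)).mono' (Continuous.aestronglyMeasurable (by fun_prop))
      (ae_of_all _ fun σ => ?_)
    rw [Real.norm_of_nonneg (mul_nonneg (Real.sqrt_nonneg _) (Hm_nonneg _ _))]
    set r := σ / (2 * π) with hr
    have hσ : σ = 2 * π * r := by rw [hr]; field_simp
    have h1 : Real.sqrt (1 + σ ^ 2) ≤ (2 * π) ^ 2 * (1 + r ^ 2) := by
      apply (Real.sqrt_le_iff.2 ⟨by positivity, by nlinarith [sq_nonneg σ]⟩ : _ ≤ 1 + σ ^ 2).trans
      rw [hσ]; nlinarith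
    calc _ ≤ (2 * π) ^ 2 * (1 + r ^ 2) * (C * ((1 + r ^ 2)⁻¹) ^ 2) :=
          mul_le_mul h1 (hb r) (Hm_nonneg _ _) (by positivity)
      _ = _ := by
        have : 1 + r ^ 2 ≠ 0 := by positivity
        field_simp
  have hle : ∫ σ in Set.Ioi (0:ℝ), σ * Hm G (σ / (2 * π))
      ≤ ∫ σ : ℝ, Real.sqrt (1 + σ ^ 2) * Hm G (σ / (2 * π)) := by
    refine le_trans (integral_mono_of_nonneg ?_ hint.integrableOn ?_)
      (setIntegral_le_integral hint (ae_of_all _ fun σ =>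
        mul_nonneg (Real.sqrt_nonneg _) (Hm_nonneg _ _)))
    · filter_upwards [ae_restrict_mem measurableSet_Ioi] with σ hσ
      exact mul_nonneg (le_of_lt hσ) (Hm_nonneg _ _)
    · refine ae_of_all _ fun σ => ?_
      exact mul_le_mul_of_nonneg_right (Real.le_sqrt_of_sq_le (by linarith)) (Hm_nonneg _ _)
  rw [hsc, ← hL] at hle
  have h0 : 0 ≤ ∫ x : ℝ × ℝ, ‖f x‖ ^ 2 := integral_nonneg fun x => by positivity
  rw [one_div, ← Real.sqrt_inv, ← Real.sqrt_mul (by norm_num)]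
  apply Real.sqrt_le_sqrt
  have h1 : 2 * ∫ x : ℝ × ℝ, ‖f x‖ ^ 2 ≤ (2 * π) ^ 2 * ∫ x : ℝ × ℝ, ‖f x‖ ^ 2 :=
    mul_le_mul_of_nonneg_right (by nlinarith) h0
  linarith
end

section
/- Let (M,g) be a two-dimensional compact Riemannian manifold with smooth boundary and nonpositive Gaussian curvature K ≤ 0, satisfying the skew-adjointness of X, V and the structure equations. Then for all u ∈ C_c^∞(SM^int), ‖VXu‖_{L²(SM)} ≥ ‖Xu‖_{L²(SM)}. -/
open scoped RealInnerProductSpace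

/-- The energy estimate `‖VXu‖ ≥ ‖Xu‖` on a two-dimensional compact manifold with
boundary and nonpositive Gaussian curvature `K ≤ 0`. Here `X`, `V`, `Xp = X_⊥` are the
geodesic, vertical and perpendicular vector fields acting as skew-adjoint operators in
`L²(SM)`, `K` is multiplication by the (nonpositive) Gaussian curvature, and the
structure equations `[X,V] = X_⊥`, `[V,X_⊥] = X`, `[X,X_⊥] = -KV` hold. -/
theorem energy_estimate_nonpositive_curvature
    {E : Type*} [NormedAddCommGroup E] [InnerProductSpace ℝ E]
    (X V Xp K : E →ₗ[ℝ] E)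
    (hX : ∀ u w : E, ⟪X u, w⟫ = -⟪u, X w⟫)
    (hV : ∀ u w : E, ⟪V u, w⟫ = -⟪u, V w⟫)
    (hXp : ∀ u w : E, ⟪Xp u, w⟫ = -⟪u, Xp w⟫)
    (hK : ∀ u w : E, ⟪K u, w⟫ = ⟪u, K w⟫)
    (hKneg : ∀ w : E, ⟪K w, w⟫ ≤ 0)
    (c1 : X ∘ₗ V - V ∘ₗ X = Xp)
    (c2 : V ∘ₗ Xp - Xp ∘ₗ V = X)
    (c3 : X ∘ₗ Xp - Xp ∘ₗ X = -(K ∘ₗ V))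
    (u : E) :
    ‖X u‖ ≤ ‖V (X u)‖ := by
  have e1 : X (V u) - V (X u) = Xp u := LinearMap.congr_fun c1 u
  have e2 : V (Xp u) - Xp (V u) = X u := LinearMap.congr_fun c2 u
  have e3 : X (Xp u) - Xp (X u) = -(K (V u)) := LinearMap.congr_fun c3 u
  have h1 : ⟪X (V u), X (V u)⟫ - ⟪V (X u), V (X u)⟫
      = ⟪V (X u), Xp u⟫ + ⟪X (V u), Xp u⟫ := by
    rw [← e1]
    simp only [inner_sub_right]
    rw [real_inner_comm (X (V u)) (V (X u))]
    ring
  have h2 : ⟪V (X u), Xp u⟫ = -⟪X u, V (Xp u)⟫ := hV _ _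
  have h3 : ⟪X (V u), Xp u⟫ = -⟪V u, X (Xp u)⟫ := hX _ _
  have h4 : ⟪Xp (V u), X u⟫ = -⟪V u, Xp (X u)⟫ := hXp _ _
  have h5 : ⟪X u, V (Xp u)⟫ - ⟪X u, Xp (V u)⟫ = ⟪X u, X u⟫ := by
    rw [← inner_sub_right, e2]
  have h6 : ⟪V u, X (Xp u)⟫ - ⟪V u, Xp (X u)⟫ = -⟪V u, K (V u)⟫ := by
    rw [← inner_sub_right, e3, inner_neg_right]
  have h7 := hKneg (V u)
  rw [hK] at h7
  rw [real_inner_comm] at h4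
  have h8 : 0 ≤ ⟪X (V u), X (V u)⟫ := real_inner_self_nonneg
  refine (sq_le_sq₀ (norm_nonneg _) (norm_nonneg _)).1 ?_
  rw [← real_inner_self_eq_norm_sq, ← real_inner_self_eq_norm_sq]
  linarith
end
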